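/- arXiv:2306.15707 — 2 statements merged into one kernel-verified Lean document; each statement's English description precedes it below -/
import Mathlib

section
/- For every θ ∈ [5π/6, π] and each i ∈ {1,2,3,4}: I_i² = Id, I_i* H I_i = H (so I_i preserves the Hermitian form of signature (3,1)), and det I_i = −1. Moreover J⁴ = Id, J* H J = H, J·p₀ = p₀, and J·I_i·J⁻¹ = I_{i+1} (indices mod 4), so the configuration has a ℤ₄-symmetry. -/
open Complex ComplexConjugate Matrix Polynomial

noncomputable section

/-- Signature (3,1) weights of the Hermitian form `H = diag(1,1,1,-1)`. -/
def eta4 : Fin 4 → ℂ := ![1, 1, 1, -1]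

/-- The Hermitian matrix `H = diag(1,1,1,-1)`. -/
def H4 : Matrix (Fin 4) (Fin 4) ℂ := Matrix.diagonal eta4

/-- The Hermitian form `⟨z,w⟩ = z₁ conj w₁ + z₂ conj w₂ + z₃ conj w₃ - z₄ conj w₄`. -/
def herm4 (z w : Fin 4 → ℂ) : ℂ :=
  z 0 * conj (w 0) + z 1 * conj (w 1) + z 2 * conj (w 2) - z 3 * conj (w 3)

/-- The (real) value `⟨z,z⟩` of the Hermitian form. -/
def q4 (z : Fin 4 → ℂ) : ℝ :=
  Complex.normSq (z 0) + Complex.normSq (z 1) + Complex.normSq (z 2) - Complex.normSq (z 3)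

/-- The order-4 symmetry `J = diag(-1, i, -i, 1)`. -/
def J4 : Matrix (Fin 4) (Fin 4) ℂ := Matrix.diagonal ![-1, Complex.I, -Complex.I, 1]

/-- The polar vector `n₁` of the paper. -/
def n1v (θ : ℝ) : Fin 4 → ℂ :=
  ![((Real.sqrt (1 - 2 * Real.cos θ) / 2 : ℝ) : ℂ),
    ((Real.sqrt (1 - 2 * Real.sin θ) / 2 : ℝ) : ℂ),
    ((Real.sqrt (1 + 2 * Real.sin θ) / 2 : ℝ) : ℂ),
    ((Real.sqrt (-1 - 2 * Real.cos θ) / 2 : ℝ) : ℂ)]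

/-- `nvec θ k` is the vector `n_{k+1}` of the paper, i.e. `J^k n₁`. -/
def nvec (θ : ℝ) (k : Fin 4) : Fin 4 → ℂ := (J4 ^ (k : ℕ)).mulVec (n1v θ)

/-- The matrix of the order-two complex reflection `z ↦ -z + 2⟨z,n⟩ n`. -/
def refl4 (n : Fin 4 → ℂ) : Matrix (Fin 4) (Fin 4) ℂ :=
  -(1 : Matrix (Fin 4) (Fin 4) ℂ) +
    (2 : ℂ) • Matrix.vecMulVec n (fun k => conj (n k) * eta4 k)

/-- `Iref θ k` is the complex reflection `I_{k+1}` of the paper. -/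
def Iref (θ : ℝ) (k : Fin 4) : Matrix (Fin 4) (Fin 4) ℂ := refl4 (nvec θ k)

/-- `Amat θ k` is `A_{k+1} = I_{k+1} · I_{k+2}` (indices mod 4). -/
def Amat (θ : ℝ) (k : Fin 4) : Matrix (Fin 4) (Fin 4) ℂ := Iref θ k * Iref θ (k + 1)

/-- The Dirichlet center `p₀ = (0,0,0,1)ᵗ`. -/
def p0v : Fin 4 → ℂ := ![0, 0, 0, 1]

/-- `pv θ i j` is `p_{(i+1)(j+1)} = I_{i+1} I_{j+1} p₀`. -/
def pv (θ : ℝ) (i j : Fin 4) : Fin 4 → ℂ := (Iref θ i * Iref θ j).mulVec p0v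

lemma aux_sqrt (θ : ℝ) (hθ : θ ∈ Set.Icc (5 * Real.pi / 6) Real.pi) :
    Real.cos θ ≤ -(1/2) ∧ |Real.sin θ| ≤ 1/2 := by
  obtain ⟨h1, h2⟩ := hθ
  have hp := Real.pi_pos
  have hs0 : 0 ≤ Real.sin θ := Real.sin_nonneg_of_nonneg_of_le_pi (by linarith) h2
  have hs : Real.sin θ ≤ 1/2 := by
    rw [← Real.sin_pi_sub, ← Real.sin_pi_div_six]
    exact Real.sin_le_sin_of_le_of_le_pi_div_two (by linarith) (by linarith) (by linarith)
  have hc : Real.cos θ ≤ 0 :=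
    Real.cos_nonpos_of_pi_div_two_le_of_le (by linarith) (by linarith)
  refine ⟨?_, by rw [abs_of_nonneg hs0]; exact hs⟩
  nlinarith [Real.sin_sq_add_cos_sq θ]

lemma J4_pow (k : ℕ) :
    J4 ^ k = Matrix.diagonal ((![-1, Complex.I, -Complex.I, 1] : Fin 4 → ℂ) ^ k) := by
  rw [J4, Matrix.diagonal_pow]

lemma J4_pow_four : J4 ^ 4 = 1 := by
  rw [J4_pow, ← Matrix.diagonal_one]
  congr 1
  ext j
  fin_cases j <;> simp [Even.neg_pow (by decide : Even 4)]

lemma J4_form : J4.conjTranspose * H4 * J4 = H4 := by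
  rw [J4, H4, Matrix.diagonal_conjTranspose, Matrix.diagonal_mul_diagonal,
    Matrix.diagonal_mul_diagonal]
  congr 1
  ext j
  fin_cases j <;> simp [eta4]

lemma n1v_norm (θ : ℝ) (hθ : θ ∈ Set.Icc (5 * Real.pi / 6) Real.pi) :
    (fun k => conj (n1v θ k) * eta4 k) ⬝ᵥ n1v θ = 1 := by
  obtain ⟨hc, hs⟩ := aux_sqrt θ hθ
  rw [abs_le] at hs
  have e1 := Real.mul_self_sqrt (show 0 ≤ 1 - 2 * Real.cos θ by linarith)
  have e2 := Real.mul_self_sqrt (show 0 ≤ 1 - 2 * Real.sin θ by linarith)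
  have e3 := Real.mul_self_sqrt (show 0 ≤ 1 + 2 * Real.sin θ by linarith)
  have e4 := Real.mul_self_sqrt (show 0 ≤ -1 - 2 * Real.cos θ by linarith)
  simp only [dotProduct, Fin.sum_univ_four, n1v, eta4, Matrix.cons_val, Complex.conj_ofReal]
  generalize Real.sqrt (1 - 2 * Real.cos θ) = a at *
  generalize Real.sqrt (1 - 2 * Real.sin θ) = b at *
  generalize Real.sqrt (1 + 2 * Real.sin θ) = c at *
  generalize Real.sqrt (-1 - 2 * Real.cos θ) = d at *
  have hr : a * a + b * b + c * c - d * d = 4 := by linarith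
  have hC : (a : ℂ) * a + b * b + c * c - d * d = 4 := by exact_mod_cast hr
  push_cast
  linear_combination hC / 4

lemma nvec_apply (θ : ℝ) (k j : Fin 4) :
    nvec θ k j = (![-1, Complex.I, -Complex.I, 1] : Fin 4 → ℂ) j ^ (k : ℕ) * n1v θ j := by
  rw [nvec, J4_pow, Matrix.mulVec_diagonal]; rfl

lemma unit_entry (j : Fin 4) :
    conj ((![-1, Complex.I, -Complex.I, 1] : Fin 4 → ℂ) j) *
      (![-1, Complex.I, -Complex.I, 1] : Fin 4 → ℂ) j = 1 := by
  fin_cases j <;> simp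

lemma nvec_norm (θ : ℝ) (hθ : θ ∈ Set.Icc (5 * Real.pi / 6) Real.pi) (k : Fin 4) :
    (fun j => conj (nvec θ k j) * eta4 j) ⬝ᵥ nvec θ k = 1 := by
  rw [← n1v_norm θ hθ]
  refine Finset.sum_congr rfl fun j _ => ?_
  have h := congrArg (· ^ (k : ℕ)) (unit_entry j)
  simp only [mul_pow, one_pow] at h
  simp only [nvec_apply, map_mul, map_pow]
  linear_combination (conj (n1v θ j) * eta4 j * n1v θ j) * h

lemma nvec_succ (θ : ℝ) (k : Fin 4) : nvec θ (k + 1) = J4 *ᵥ nvec θ k := by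
  have h : J4 ^ ((k + 1 : Fin 4) : ℕ) = J4 * J4 ^ (k : ℕ) := by
    rw [← pow_succ']
    fin_cases k
    · rfl
    · rfl
    · rfl
    · exact (pow_zero J4).trans J4_pow_four.symm
  rw [nvec, nvec, h, Matrix.mulVec_mulVec]

lemma refl4_sq (n : Fin 4 → ℂ) (h : (fun j => conj (n j) * eta4 j) ⬝ᵥ n = 1) :
    refl4 n * refl4 n = 1 := by
  have hv : Matrix.vecMulVec n (fun k => conj (n k) * eta4 k) *
      Matrix.vecMulVec n (fun k => conj (n k) * eta4 k) =
      Matrix.vecMulVec n (fun k => conj (n k) * eta4 k) := by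
    rw [Matrix.vecMulVec_mul_vecMulVec, h, one_smul]
  rw [refl4]
  generalize Matrix.vecMulVec n (fun k => conj (n k) * eta4 k) = P at hv
  simp only [add_mul, mul_add, neg_mul, mul_neg, one_mul, mul_one, smul_mul_assoc,
    mul_smul_comm, hv]
  module

lemma refl4_herm (n : Fin 4 → ℂ) : (refl4 n).conjTranspose * H4 = H4 * refl4 n := by
  ext a b
  rw [H4, Matrix.mul_diagonal, Matrix.diagonal_mul]
  fin_cases a <;> fin_cases b <;>
    simp [refl4, eta4, Matrix.vecMulVec_apply] <;> ring

lemma refl4_det (n : Fin 4 → ℂ) (h : (fun j => conj (n j) * eta4 j) ⬝ᵥ n = 1) :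
    (refl4 n).det = -1 := by
  have e : refl4 n = -(1 + Matrix.vecMulVec ((-2 : ℂ) • n) (fun k => conj (n k) * eta4 k)) := by
    rw [refl4, Matrix.smul_vecMulVec]; module
  rw [e, Matrix.det_neg, Matrix.vecMulVec_eq Unit, Matrix.det_one_add_replicateCol_mul_replicateRow,
    dotProduct_smul, h]
  simp; norm_num

lemma refl4_J (n : Fin 4 → ℂ) : J4 * refl4 n = refl4 (J4 *ᵥ n) * J4 := by
  ext a b
  have hb := unit_entry b
  simp only [refl4, J4, Matrix.mul_diagonal, Matrix.diagonal_mul, Matrix.add_apply,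
    Matrix.neg_apply, Matrix.smul_apply, Matrix.vecMulVec_apply, Matrix.mulVec_diagonal, map_mul,
    smul_eq_mul]
  by_cases hab : a = b
  · subst hab
    linear_combination (-2 * (![-1, Complex.I, -Complex.I, 1] : Fin 4 → ℂ) a * n a * conj (n a)
      * eta4 a) * hb
  · rw [Matrix.one_apply_ne hab]
    linear_combination (-2 * (![-1, Complex.I, -Complex.I, 1] : Fin 4 → ℂ) a * n a * conj (n b)
      * eta4 b) * hb

/-- for `θ ∈ [5π/6, π]` and each `i`: `I_i² = Id`, `I_i* H I_i = H`,
`det I_i = -1`; moreover `J⁴ = Id`, `J* H J = H`, `J p₀ = p₀` and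
`J I_i J⁻¹ = I_{i+1}` (indices mod 4), the `ℤ₄`-symmetry.
(Here `Iref θ k` is `I_{k+1}`, so indices are shifted by one.) -/
theorem reflections_preserve_form_and_Z4_symmetry (θ : ℝ)
    (hθ : θ ∈ Set.Icc (5 * Real.pi / 6) Real.pi) (i : Fin 4) :
    Iref θ i * Iref θ i = 1 ∧
    (Iref θ i).conjTranspose * H4 * Iref θ i = H4 ∧
    (Iref θ i).det = -1 ∧
    J4 ^ 4 = 1 ∧
    J4.conjTranspose * H4 * J4 = H4 ∧
    J4.mulVec p0v = p0v ∧
    J4 * Iref θ i * J4⁻¹ = Iref θ (i + 1) := by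
  have hn := nvec_norm θ hθ i
  refine ⟨refl4_sq _ hn, ?_, refl4_det _ hn, J4_pow_four, J4_form, ?_, ?_⟩
  · rw [Iref, refl4_herm, Matrix.mul_assoc, refl4_sq _ hn, Matrix.mul_one]
  · ext j
    rw [J4, Matrix.mulVec_diagonal]
    fin_cases j <;> simp [p0v]
  · have hu : IsUnit J4.det := by
      rw [← Matrix.isUnit_iff_isUnit_det]
      exact IsUnit.of_pow_eq_one J4_pow_four (by norm_num)
    rw [Iref, Iref, refl4_J, Matrix.mul_assoc, Matrix.mul_nonsing_inv _ hu, Matrix.mul_one,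
      nvec_succ]
end
end

section
/- (Theorem on the Dirichlet domain at θ = 5π/6: discreteness and faithfulness in PU(2,1).) In the ℂ³ setting, the matrices A₁, A₂, A₃, A₄ ∈ GL(3,ℂ) satisfy A₁A₂A₃A₄ = Id and (A₁A₂)² = (A₂A₃)² = (A₃A₄)² = (A₄A₁)² = Id; the induced group homomorphism from the presented group K = ⟨a₁,a₂,a₃,a₄ | a₁a₂a₃a₄ = (a₁a₂)² = (a₂a₃)² = (a₃a₄)² = (a₄a₁)² = 1⟩ to GL(3,ℂ) sending a_i to A_i is injective; and the subgroup of GL(3,ℂ) generated by A₁, A₂, A₃, A₄ is discrete, i.e. it carries the discrete topology as a topological subspace of GL(3,ℂ). -/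
open Complex ComplexConjugate Matrix

noncomputable section

/-- Signature (2,1) weights of the Hermitian form `H = diag(1,1,-1)`. -/
def eta3 : Fin 3 → ℂ := ![1, 1, -1]

/-- The Hermitian form `⟨z,w⟩ = z₁ conj w₁ + z₂ conj w₂ - z₃ conj w₃`. -/
def herm3 (z w : Fin 3 → ℂ) : ℂ :=
  z 0 * conj (w 0) + z 1 * conj (w 1) - z 2 * conj (w 2)

/-- The (real) value `⟨z,z⟩` of the Hermitian form. -/
def q3 (z : Fin 3 → ℂ) : ℝ :=
  Complex.normSq (z 0) + Complex.normSq (z 1) - Complex.normSq (z 2)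

/-- The order-4 symmetry `J = diag(-1, -i, 1)`. -/
def J3 : Matrix (Fin 3) (Fin 3) ℂ := Matrix.diagonal ![-1, -Complex.I, 1]

/-- The polar vector `n₁` at `θ = 5π/6`. -/
def n1w : Fin 3 → ℂ :=
  ![((Real.sqrt (1 + Real.sqrt 3) / 2 : ℝ) : ℂ),
    ((Real.sqrt 2 / 2 : ℝ) : ℂ),
    ((Real.sqrt (Real.sqrt 3 - 1) / 2 : ℝ) : ℂ)]

/-- `nw k` is the vector `n_{k+1}`, i.e. `J^k n₁`. -/
def nw (k : Fin 4) : Fin 3 → ℂ := (J3 ^ (k : ℕ)).mulVec n1w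

/-- The matrix of the order-two complex reflection `z ↦ -z + 2⟨z,n⟩ n`. -/
def refl3 (n : Fin 3 → ℂ) : Matrix (Fin 3) (Fin 3) ℂ :=
  -(1 : Matrix (Fin 3) (Fin 3) ℂ) +
    (2 : ℂ) • Matrix.vecMulVec n (fun k => conj (n k) * eta3 k)

/-- `Iw k` is the complex reflection `I_{k+1}`. -/
def Iw (k : Fin 4) : Matrix (Fin 3) (Fin 3) ℂ := refl3 (nw k)

/-- `Aw k` is `A_{k+1} = I_{k+1} · I_{k+2}` (indices mod 4). -/
def Aw (k : Fin 4) : Matrix (Fin 3) (Fin 3) ℂ := Iw k * Iw (k + 1)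

/-- The Dirichlet center `p₀ = (0,0,1)ᵗ`. -/
def p0w : Fin 3 → ℂ := ![0, 0, 1]

/-- `pw i j` is `p_{(i+1)(j+1)} = I_{i+1} I_{j+1} p₀`. -/
def pw (i j : Fin 4) : Fin 3 → ℂ := (Iw i * Iw j).mulVec p0w

/-- The relations of the presented group
`K = ⟨a₁,a₂,a₃,a₄ | a₁a₂a₃a₄ = (a₁a₂)² = (a₂a₃)² = (a₃a₄)² = (a₄a₁)² = 1⟩`
(generators indexed by `Fin 4`, with `a_{k+1}` corresponding to index `k`). -/
def relsK : Set (FreeGroup (Fin 4)) :=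
  { FreeGroup.of 0 * FreeGroup.of 1 * FreeGroup.of 2 * FreeGroup.of 3,
    (FreeGroup.of 0 * FreeGroup.of 1) ^ 2,
    (FreeGroup.of 1 * FreeGroup.of 2) ^ 2,
    (FreeGroup.of 2 * FreeGroup.of 3) ^ 2,
    (FreeGroup.of 3 * FreeGroup.of 0) ^ 2 }


/-! ### Part 1: group theory -/

abbrev KK := PresentedGroup relsK

abbrev ka (i : Fin 4) : KK := PresentedGroup.of i

theorem rel_mk {r : FreeGroup (Fin 4)} (h : r ∈ relsK) : PresentedGroup.mk relsK r = 1 :=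
  (PresentedGroup.mk_eq_one_iff).2 (Subgroup.subset_normalClosure h)

theorem k_prod : ka 0 * ka 1 * ka 2 * ka 3 = 1 :=
  rel_mk (r := FreeGroup.of 0 * FreeGroup.of 1 * FreeGroup.of 2 * FreeGroup.of 3)
    (by simp [relsK])
theorem k_01 : (ka 0 * ka 1) ^ 2 = 1 :=
  rel_mk (r := (FreeGroup.of 0 * FreeGroup.of 1) ^ 2) (by simp [relsK])
theorem k_12 : (ka 1 * ka 2) ^ 2 = 1 :=
  rel_mk (r := (FreeGroup.of 1 * FreeGroup.of 2) ^ 2) (by simp [relsK])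
theorem k_23 : (ka 2 * ka 3) ^ 2 = 1 :=
  rel_mk (r := (FreeGroup.of 2 * FreeGroup.of 3) ^ 2) (by simp [relsK])
theorem k_30 : (ka 3 * ka 0) ^ 2 = 1 :=
  rel_mk (r := (FreeGroup.of 3 * FreeGroup.of 0) ^ 2) (by simp [relsK])

/-- Universal property of `K`. -/
theorem k_lift {G : Type*} [Group G] (u : Fin 4 → G)
    (h0 : u 0 * u 1 * u 2 * u 3 = 1) (h1 : (u 0 * u 1) ^ 2 = 1) (h2 : (u 1 * u 2) ^ 2 = 1)
    (h3 : (u 2 * u 3) ^ 2 = 1) (h4 : (u 3 * u 0) ^ 2 = 1) :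
    ∃ φ : KK →* G, ∀ i, φ (ka i) = u i := by
  refine ⟨PresentedGroup.toGroup (f := u) ?_, fun i => PresentedGroup.toGroup.of _⟩
  intro r hr
  simp only [relsK, Set.mem_insert_iff, Set.mem_singleton_iff] at hr
  rcases hr with rfl | rfl | rfl | rfl | rfl <;> simpa using by assumption

theorem k_ext {G : Type*} [Group G] {f g : KK →* G} (h : ∀ i, f (ka i) = g (ka i)) : f = g :=
  PresentedGroup.ext h

/-- The hom of `K` attached to four involutions, opposite ones commuting. -/
theorem even_lift {G : Type*} [Group G] (u : Fin 4 → G) (hu : ∀ i, u i * u i = 1)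
    (h02 : u 0 * u 2 = u 2 * u 0) (h13 : u 1 * u 3 = u 3 * u 1) :
    ∃ φ : KK →* G, ∀ i, φ (ka i) = u i * u (i + 1) := by
  have c : ∀ i x, u i * (u i * x) = x := fun i x => by rw [← mul_assoc, hu, one_mul]
  have e02 : (u 0 * u 2) ^ 2 = 1 := by
    rw [pow_two]; nth_rewrite 2 [h02]; simp only [mul_assoc, c, hu]
  have e13 : (u 1 * u 3) ^ 2 = 1 := by
    rw [pow_two]; nth_rewrite 2 [h13]; simp only [mul_assoc, c, hu]
  apply k_lift (fun i => u i * u (i + 1))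
  · show u 0 * u 1 * (u 1 * u 2) * (u 2 * u 3) * (u 3 * u 0) = 1
    simp only [mul_assoc, c, hu]
  · show (u 0 * u 1 * (u 1 * u 2)) ^ 2 = 1
    simp only [mul_assoc, c, e02]
  · show (u 1 * u 2 * (u 2 * u 3)) ^ 2 = 1
    simp only [mul_assoc, c, e13]
  · show (u 2 * u 3 * (u 3 * u 0)) ^ 2 = 1
    simp only [mul_assoc, c, ← h02, e02]
  · show (u 3 * u 0 * (u 0 * u 1)) ^ 2 = 1
    simp only [mul_assoc, c, ← h13, e13]

theorem sq_one_inv {G : Type*} [Group G] {a b : G} (h : (a * b) ^ 2 = 1) :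
    b⁻¹ * a⁻¹ = a * b := by
  rw [← _root_.mul_inv_rev]; exact inv_eq_of_mul_eq_one_left (by rw [← pow_two, h])

theorem exists_sigma : ∃ s : KK →* KK, (∀ x, s (s x) = x) ∧ s (ka 0) = (ka 0)⁻¹ ∧
    s (ka 1) = ka 0 * (ka 1)⁻¹ * (ka 0)⁻¹ ∧ s (ka 2) = ka 0 * ka 1 * ka 3 ∧
    s (ka 3) = (ka 3)⁻¹ := by
  have e30 : (ka 0 * ka 3) ^ 2 = 1 := by
    have h := k_30
    rw [pow_two] at h ⊢
    have := congrArg (fun x => ka 0 * x * (ka 0)⁻¹) h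
    simpa [mul_assoc] using this
  obtain ⟨s, hs⟩ := k_lift (G := KK)
    ![(ka 0)⁻¹, ka 0 * (ka 1)⁻¹ * (ka 0)⁻¹, ka 0 * ka 1 * ka 3, (ka 3)⁻¹]
    (by simp [mul_assoc])
    (by simp only [Matrix.cons_val]
        have : (ka 0)⁻¹ * (ka 0 * (ka 1)⁻¹ * (ka 0)⁻¹) = (ka 0 * ka 1)⁻¹ := by group
        rw [this, inv_pow, k_01, inv_one])
    (by simp only [Matrix.cons_val]
        have : ka 0 * (ka 1)⁻¹ * (ka 0)⁻¹ * (ka 0 * ka 1 * ka 3) = ka 0 * ka 3 := by group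
        rw [this, e30])
    (by simp only [Matrix.cons_val]
        have : ka 0 * ka 1 * ka 3 * (ka 3)⁻¹ = ka 0 * ka 1 := by group
        rw [this, k_01])
    (by simp only [Matrix.cons_val]
        have : (ka 3)⁻¹ * (ka 0)⁻¹ = (ka 0 * ka 3)⁻¹ := by group
        rw [this, inv_pow, e30, inv_one])
  have s0 : s (ka 0) = (ka 0)⁻¹ := hs 0
  have s1 : s (ka 1) = ka 0 * (ka 1)⁻¹ * (ka 0)⁻¹ := hs 1
  have s2 : s (ka 2) = ka 0 * ka 1 * ka 3 := hs 2
  have s3 : s (ka 3) = (ka 3)⁻¹ := hs 3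
  refine ⟨s, ?_, s0, s1, s2, s3⟩
  have : s.comp s = MonoidHom.id KK := by
    apply k_ext
    intro i
    fin_cases i
    · simp [s0]
    · simp [s0, s1, mul_assoc]
    · have h2 : ka 2 = (ka 0 * ka 1)⁻¹ * (ka 3)⁻¹ := by
        have h := eq_inv_of_mul_eq_one_left k_prod
        rw [← h]; group
      show s (s (ka 2)) = ka 2
      rw [s2, map_mul, map_mul, s0, s1, s3, h2]
      group
    · simp [s3]
  intro x
  exact DFunLike.congr_fun this x

/-- Klein four-group. -/
abbrev VV := Multiplicative (ZMod 2) × Multiplicative (ZMod 2)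

def sg : Multiplicative (ZMod 2) := Multiplicative.ofAdd 1

theorem z2_cases (p : Multiplicative (ZMod 2)) : p = 1 ∨ p = sg := by
  revert p; unfold sg; decide

theorem sg_ne : sg ≠ 1 := by unfold sg; decide
theorem sg_mul : sg * sg = 1 := by unfold sg; decide

def vHom {G : Type*} [Group G] (a b : G) (ha : a * a = 1) (hb : b * b = 1)
    (hab : a * b = b * a) : VV →* G where
  toFun v := (if v.1 = 1 then 1 else a) * (if v.2 = 1 then 1 else b)
  map_one' := by simp
  map_mul' := by
    have ca : ∀ x, a * (a * x) = x := fun x => by rw [← mul_assoc, ha, one_mul]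
    have cb : ∀ x, b * (b * x) = x := fun x => by rw [← mul_assoc, hb, one_mul]
    have cab : ∀ x, b * (a * x) = a * (b * x) := fun x => by
      rw [← mul_assoc, ← hab, mul_assoc]
    rintro ⟨p, q⟩ ⟨p', q'⟩
    rcases z2_cases p with rfl | rfl <;> rcases z2_cases q with rfl | rfl <;>
    rcases z2_cases p' with rfl | rfl <;> rcases z2_cases q' with rfl | rfl <;>
    simp [sg_ne, sg_mul, ha, hb, ca, cb, cab, mul_assoc, ← hab]

abbrev WW := Monoid.CoprodI (fun _ : Bool => VV)

def wgen : Fin 4 → WW :=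
  ![Monoid.CoprodI.of (i := false) (sg, 1), Monoid.CoprodI.of (i := true) (sg, 1),
    Monoid.CoprodI.of (i := false) (1, sg), Monoid.CoprodI.of (i := true) (1, sg)]

theorem wgen_sq (i : Fin 4) : wgen i * wgen i = 1 := by
  fin_cases i <;> simp [wgen, ← map_mul, sg_mul, Prod.mk_mul_mk, ← Prod.one_eq_mk]

theorem wgen_02 : wgen 0 * wgen 2 = wgen 2 * wgen 0 := by
  simp [wgen, ← map_mul]
theorem wgen_13 : wgen 1 * wgen 3 = wgen 3 * wgen 1 := by
  simp [wgen, ← map_mul]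

/-- the family of homs attached to four involutions -/
def wFam {G : Type*} [Group G] (u : Fin 4 → G) (hu : ∀ i, u i * u i = 1)
    (h02 : u 0 * u 2 = u 2 * u 0) (h13 : u 1 * u 3 = u 3 * u 1) (c : Bool) : VV →* G :=
  match c with
  | false => vHom (u 0) (u 2) (hu 0) (hu 2) h02
  | true => vHom (u 1) (u 3) (hu 1) (hu 3) h13

theorem wlift_gen {G : Type*} [Group G] (u : Fin 4 → G) (hu : ∀ i, u i * u i = 1)
    (h02 : u 0 * u 2 = u 2 * u 0) (h13 : u 1 * u 3 = u 3 * u 1) (i : Fin 4) :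
    Monoid.CoprodI.lift (wFam u hu h02 h13) (wgen i) = u i := by
  fin_cases i <;> simp [wgen, wFam, vHom, sg_ne]

/-- The embedding of `K` in the free product. -/
theorem kw_injective (f : KK →* WW) (hf : ∀ i, f (ka i) = wgen i * wgen (i + 1)) :
    Function.Injective f := by
  obtain ⟨s, ss, s0, s1, s2, s3⟩ := exists_sigma
  let S : Equiv.Perm KK := ⟨s, s, ss, ss⟩
  let L : KK →* Equiv.Perm KK := MulAction.toPermHom KK KK
  have Linj : Function.Injective L := MulAction.toPerm_injective
  have SL : ∀ k, S * L k * S = L (s k) := by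
    intro k
    ext x
    show s (k * s x) = s k * x
    rw [map_mul, ss]
  have SS : S * S = 1 := by ext x; exact ss x
  have SSc : ∀ x, S * (S * x) = x := fun x => by rw [← mul_assoc, SS, one_mul]
  have SLc : ∀ k x, S * (L k * (S * x)) = L (s k) * x := fun k x => by
    rw [← SL]; simp only [mul_assoc]
  have h3 : ka 0 * ka 1 * ka 2 = (ka 3)⁻¹ := eq_inv_of_mul_eq_one_left k_prod
  let u : Fin 4 → Equiv.Perm KK := ![S, S * L (ka 0), S * L (ka 0 * ka 1), S * L ((ka 3)⁻¹)]
  have s01 : s (ka 0 * ka 1) = (ka 0 * ka 1)⁻¹ := by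
    rw [map_mul, s0, s1]; group
  have s3' : s ((ka 3)⁻¹) = ka 3 := by rw [map_inv, s3, inv_inv]
  have hu : ∀ i, u i * u i = 1 := by
    intro i
    fin_cases i
    · exact SS
    · show S * L (ka 0) * (S * L (ka 0)) = 1
      rw [mul_assoc, SLc, ← map_mul, s0]; simp
    · show S * L (ka 0 * ka 1) * (S * L (ka 0 * ka 1)) = 1
      rw [mul_assoc, SLc, ← map_mul, s01]; simp only [inv_mul_cancel, map_one]
    · show S * L ((ka 3)⁻¹) * (S * L ((ka 3)⁻¹)) = 1
      rw [mul_assoc, SLc, ← map_mul, s3']; simp only [mul_inv_cancel, map_one]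
  have h02 : u 0 * u 2 = u 2 * u 0 := by
    show S * (S * L (ka 0 * ka 1)) = S * L (ka 0 * ka 1) * S
    rw [SSc, SL, s01]
    congr 1
    exact (inv_eq_of_mul_eq_one_left (by rw [← pow_two, k_01])).symm
  have h13 : u 1 * u 3 = u 3 * u 1 := by
    show S * L (ka 0) * (S * L ((ka 3)⁻¹)) = S * L ((ka 3)⁻¹) * (S * L (ka 0))
    rw [mul_assoc, mul_assoc, SLc, SLc, ← map_mul, ← map_mul, s0, s3', sq_one_inv k_30]
  let g : WW →* Equiv.Perm KK := Monoid.CoprodI.lift (wFam u hu h02 h13)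
  have gw : ∀ i, g (wgen i) = u i := wlift_gen u hu h02 h13
  have key : g.comp f = L := by
    apply k_ext
    intro i
    rw [MonoidHom.comp_apply, hf, map_mul, gw, gw]
    fin_cases i
    · show S * (S * L (ka 0)) = L (ka 0)
      rw [SSc]
    · show S * L (ka 0) * (S * L (ka 0 * ka 1)) = L (ka 1)
      rw [mul_assoc, SLc, ← map_mul, s0, inv_mul_cancel_left]
    · show S * L (ka 0 * ka 1) * (S * L ((ka 3)⁻¹)) = L (ka 2)
      rw [mul_assoc, SLc, ← map_mul, s01, ← h3, inv_mul_cancel_left]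
    · show S * L ((ka 3)⁻¹) * S = L (ka 3)
      rw [SL, s3']
  intro x y hxy
  apply Linj
  rw [← key, MonoidHom.comp_apply, MonoidHom.comp_apply, hxy]

/-! ### Part 2: the Eisenstein model and its quadratic forms

A complex number is written `a + b ω` with `a`, `b` real. -/

/-- `|a + b ω|²` -/
def nn (a b : ℝ) : ℝ := a ^ 2 - a * b + b ^ 2
/-- `2 Re ((a + b ω) conj (c + d ω))` -/
def pp (a b c d : ℝ) : ℝ := 2 * a * c + 2 * b * d - a * d - b * c

theorem nn_nonneg (a b : ℝ) : 0 ≤ nn a b := by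
  unfold nn; nlinarith [sq_nonneg (a - b), sq_nonneg a, sq_nonneg b]

def qq (a0 b0 a1 b1 a2 b2 : ℝ) : ℝ := nn a0 b0 + nn a1 b1 - nn a2 b2
def h1 (a0 b0 a1 b1 a2 b2 : ℝ) : ℝ := pp a0 b0 (a2 + b2 - b1) (2 * b2 - a2 - (b1 - a1))
def h3 (a0 b0 a1 b1 a2 b2 : ℝ) : ℝ := pp b1 (b1 - a1) (a2 + b2 - a0) (2 * b2 - a2 - b0)
def h13 (a0 b0 a1 b1 a2 b2 : ℝ) : ℝ := pp (a2 + b2) (2 * b2 - a2) (a0 + b1) (b0 + (b1 - a1))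
/-- the form built on `A = ⟨z,n₂⟩`, `B = ⟨z,n₄⟩`, `C = ⟨z,m₂₄⟩` (up to phases) -/
def h2 (a0 b0 a1 b1 a2 b2 : ℝ) : ℝ :=
  pp (a0 + a1 - a2) (b0 + b1 - b2)
    ((2 * a0 - b0 + a1 + b1 - 3 * a2) - (a0 - b0 + b1 - a2))
    ((a0 + b0 + 2 * b1 - a1 - 3 * b2) - (a0 + b1 - a1 - b2))
def h4 (a0 b0 a1 b1 a2 b2 : ℝ) : ℝ :=
  pp (a0 - b0 + b1 - a2) (a0 + b1 - a1 - b2)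
    ((2 * a0 - b0 + a1 + b1 - 3 * a2) - (a0 + a1 - a2))
    ((a0 + b0 + 2 * b1 - a1 - 3 * b2) - (b0 + b1 - b2))
def h24 (a0 b0 a1 b1 a2 b2 : ℝ) : ℝ :=
  pp (2 * a0 - b0 + a1 + b1 - 3 * a2) (a0 + b0 + 2 * b1 - a1 - 3 * b2)
    ((a0 + a1 - a2) + (a0 - b0 + b1 - a2)) ((b0 + b1 - b2) + (a0 + b1 - a1 - b2))

theorem cert_1_2 (a0 b0 a1 b1 a2 b2 : ℝ) :
    0 ≤ qq a0 b0 a1 b1 a2 b2 + 1 * h1 a0 b0 a1 b1 a2 b2 + 1 * h2 a0 b0 a1 b1 a2 b2 := by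
  have e0 := nn_nonneg ((-1/3) * a0 + (-1/3) * b0 + (-1) * a1 + (1) * a2) ((1/3) * a0 + (-2/3) * b0 + (-1) * b1 + (1) * b2)
  have e1 := nn_nonneg ((1) * a0) ((1) * b0)
  simp only [h1, h2, qq, nn, pp] at *
  linear_combination (3) * e0 + (2) * e1

theorem cert_1_4 (a0 b0 a1 b1 a2 b2 : ℝ) :
    0 ≤ qq a0 b0 a1 b1 a2 b2 + 1 * h1 a0 b0 a1 b1 a2 b2 + 1 * h4 a0 b0 a1 b1 a2 b2 := by
  have e0 := nn_nonneg ((-1/3) * a0 + (2/3) * b0 + (-1) * b1 + (1) * a2) ((-2/3) * a0 + (1/3) * b0 + (1) * a1 + (-1) * b1 + (1) * b2)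
  have e1 := nn_nonneg ((1) * a0) ((1) * b0)
  simp only [h1, h4, qq, nn, pp] at *
  linear_combination (3) * e0 + (2) * e1

theorem cert_1_24 (a0 b0 a1 b1 a2 b2 : ℝ) :
    0 ≤ qq a0 b0 a1 b1 a2 b2 + 1 * h1 a0 b0 a1 b1 a2 b2 + 1/2 * h24 a0 b0 a1 b1 a2 b2 := by
  have e0 := nn_nonneg ((-3/5) * a0 + (3/10) * b0 + (-1/2) * a1 + (-1/2) * b1 + (1) * a2) ((-3/10) * a0 + (-3/10) * b0 + (1/2) * a1 + (-1) * b1 + (1) * b2)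
  have e1 := nn_nonneg ((1) * a0 + (-5/53) * b1) ((1) * b0 + (5/53) * a1 + (-5/53) * b1)
  have e2 := nn_nonneg ((1) * a1) ((1) * b1)
  simp only [h1, h24, qq, nn, pp] at *
  linear_combination (5) * e0 + (53/20) * e1 + (12/53) * e2

theorem cert_3_2 (a0 b0 a1 b1 a2 b2 : ℝ) :
    0 ≤ qq a0 b0 a1 b1 a2 b2 + 1 * h3 a0 b0 a1 b1 a2 b2 + 1 * h2 a0 b0 a1 b1 a2 b2 := by
  have e0 := nn_nonneg ((-1) * a0 + (-2/3) * a1 + (1/3) * b1 + (1) * a2) ((-1) * b0 + (-1/3) * a1 + (-1/3) * b1 + (1) * b2)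
  have e1 := nn_nonneg ((1) * a1) ((1) * b1)
  simp only [h3, h2, qq, nn, pp] at *
  linear_combination (3) * e0 + (2) * e1

theorem cert_3_4 (a0 b0 a1 b1 a2 b2 : ℝ) :
    0 ≤ qq a0 b0 a1 b1 a2 b2 + 1 * h3 a0 b0 a1 b1 a2 b2 + 1 * h4 a0 b0 a1 b1 a2 b2 := by
  have e0 := nn_nonneg ((-1) * a0 + (1) * b0 + (1/3) * a1 + (-2/3) * b1 + (1) * a2) ((-1) * a0 + (2/3) * a1 + (-1/3) * b1 + (1) * b2)
  have e1 := nn_nonneg ((1) * a1) ((1) * b1)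
  simp only [h3, h4, qq, nn, pp] at *
  linear_combination (3) * e0 + (2) * e1

theorem cert_3_24 (a0 b0 a1 b1 a2 b2 : ℝ) :
    0 ≤ qq a0 b0 a1 b1 a2 b2 + 1 * h3 a0 b0 a1 b1 a2 b2 + 1/2 * h24 a0 b0 a1 b1 a2 b2 := by
  have e0 := nn_nonneg ((-1) * a0 + (1/2) * b0 + (-3/10) * a1 + (-3/10) * b1 + (1) * a2) ((-1/2) * a0 + (-1/2) * b0 + (3/10) * a1 + (-3/5) * b1 + (1) * b2)
  have e1 := nn_nonneg ((1) * a0 + (-1) * b1) ((1) * b0 + (1) * a1 + (-1) * b1)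
  have e2 := nn_nonneg ((1) * a1) ((1) * b1)
  simp only [h3, h24, qq, nn, pp] at *
  linear_combination (5) * e0 + (1/4) * e1 + (12/5) * e2

theorem cert_13_2 (a0 b0 a1 b1 a2 b2 : ℝ) :
    0 ≤ qq a0 b0 a1 b1 a2 b2 + 1/2 * h13 a0 b0 a1 b1 a2 b2 + 1 * h2 a0 b0 a1 b1 a2 b2 := by
  have e0 := nn_nonneg ((-2/3) * a0 + (-1/6) * b0 + (-5/6) * a1 + (1/6) * b1 + (1) * a2) ((1/6) * a0 + (-5/6) * b0 + (-1/6) * a1 + (-2/3) * b1 + (1) * b2)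
  have e1 := nn_nonneg ((1) * a0 + (3/5) * b1) ((1) * b0 + (-3/5) * a1 + (3/5) * b1)
  have e2 := nn_nonneg ((1) * a1) ((1) * b1)
  simp only [h13, h2, qq, nn, pp] at *
  linear_combination (3) * e0 + (5/4) * e1 + (4/5) * e2

theorem cert_13_4 (a0 b0 a1 b1 a2 b2 : ℝ) :
    0 ≤ qq a0 b0 a1 b1 a2 b2 + 1/2 * h13 a0 b0 a1 b1 a2 b2 + 1 * h4 a0 b0 a1 b1 a2 b2 := by
  have e0 := nn_nonneg ((-2/3) * a0 + (5/6) * b0 + (1/6) * a1 + (-5/6) * b1 + (1) * a2) ((-5/6) * a0 + (1/6) * b0 + (5/6) * a1 + (-2/3) * b1 + (1) * b2)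
  have e1 := nn_nonneg ((1) * a0 + (3/5) * b1) ((1) * b0 + (-3/5) * a1 + (3/5) * b1)
  have e2 := nn_nonneg ((1) * a1) ((1) * b1)
  simp only [h13, h4, qq, nn, pp] at *
  linear_combination (3) * e0 + (5/4) * e1 + (4/5) * e2

theorem cert_13_24 (a0 b0 a1 b1 a2 b2 : ℝ) :
    0 ≤ qq a0 b0 a1 b1 a2 b2 + 1/2 * h13 a0 b0 a1 b1 a2 b2 + 1/2 * h24 a0 b0 a1 b1 a2 b2 := by
  have e0 := nn_nonneg ((-4/5) * a0 + (2/5) * b0 + (-2/5) * a1 + (-2/5) * b1 + (1) * a2) ((-2/5) * a0 + (-2/5) * b0 + (2/5) * a1 + (-4/5) * b1 + (1) * b2)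
  have e1 := nn_nonneg ((1) * a0 + (3/8) * b1) ((1) * b0 + (-3/8) * a1 + (3/8) * b1)
  have e2 := nn_nonneg ((1) * a1) ((1) * b1)
  simp only [h13, h24, qq, nn, pp] at *
  linear_combination (5) * e0 + (8/5) * e1 + (11/8) * e2

def om : ℂ := ⟨-1 / 2, Real.sqrt 3 / 2⟩

theorem om_sq : om * om = -1 - om := by
  have h : Real.sqrt 3 * Real.sqrt 3 = 3 := Real.mul_self_sqrt (by norm_num)
  apply Complex.ext
  · simp only [om, Complex.mul_re, Complex.sub_re, Complex.neg_re, Complex.one_re]; linarith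
  · simp only [om, Complex.mul_im, Complex.sub_im, Complex.neg_im, Complex.one_im]; ring

def aa (z : ℂ) : ℝ := z.re + z.im / Real.sqrt 3
def bb (z : ℂ) : ℝ := 2 * (z.im / Real.sqrt 3)

theorem aa_add (z w : ℂ) : aa (z + w) = aa z + aa w := by simp [aa]; ring
theorem bb_add (z w : ℂ) : bb (z + w) = bb z + bb w := by simp [bb]; ring
theorem aa_neg (z : ℂ) : aa (-z) = -aa z := by simp [aa]; ring
theorem bb_neg (z : ℂ) : bb (-z) = -bb z := by simp [bb]; ring
theorem aa_two (z : ℂ) : aa (2 * z) = 2 * aa z := by simp [aa]; ring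
theorem bb_two (z : ℂ) : bb (2 * z) = 2 * bb z := by simp [bb]; ring
theorem aa_three (z : ℂ) : aa (3 * z) = 3 * aa z := by simp [aa]; ring
theorem bb_three (z : ℂ) : bb (3 * z) = 3 * bb z := by simp [bb]; ring
theorem aa_om (z : ℂ) : aa (om * z) = -bb z := by
  have h : Real.sqrt 3 * Real.sqrt 3 = 3 := Real.mul_self_sqrt (by norm_num)
  have h0 : Real.sqrt 3 ≠ 0 := by positivity
  simp [aa, bb, om]; field_simp; linear_combination (-z.im) * h
theorem bb_om (z : ℂ) : bb (om * z) = aa z - bb z := by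
  have h0 : Real.sqrt 3 ≠ 0 := by positivity
  simp [aa, bb, om]; field_simp; ring
theorem aa_zero : aa 0 = 0 := by simp [aa]
theorem bb_zero : bb 0 = 0 := by simp [bb]
theorem aa_one : aa 1 = 1 := by simp [aa]
theorem bb_one : bb 1 = 0 := by simp [bb]

abbrev M3 := Matrix (Fin 3) (Fin 3) ℂ

/-- The four involutions of the model. -/
def mm : Fin 4 → M3 :=
  ![!![1, 0, 0; 0, -1, 0; 0, 0, -1],
    !![1, 2, -2; 2, 1, -2; 2, 2, -3],
    !![-1, 0, 0; 0, 1, 0; 0, 0, -1],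
    !![1, 2 * (-1 - om), 2 * om; 2 * om, 1, 2 * (-1 - om); 2 * (1 + om), -(2 * om), -3]]

theorem mm_sq (i : Fin 4) : mm i * mm i = 1 := by
  have h := om_sq
  fin_cases i <;> ext i j <;> fin_cases i <;> fin_cases j <;>
    simp [mm, Matrix.mul_apply, Fin.sum_univ_three] <;> grind

def mu (i : Fin 4) : M3ˣ := ⟨mm i, mm i, mm_sq i, mm_sq i⟩

theorem mu_sq (i : Fin 4) : mu i * mu i = 1 := Units.ext (mm_sq i)

theorem mu_02 : mu 0 * mu 2 = mu 2 * mu 0 := by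
  apply Units.ext
  show mm 0 * mm 2 = mm 2 * mm 0
  ext i j; fin_cases i <;> fin_cases j <;>
    simp [mm, Matrix.mul_apply, Fin.sum_univ_three]

theorem mu_13 : mu 1 * mu 3 = mu 3 * mu 1 := by
  have h := om_sq
  apply Units.ext
  show mm 1 * mm 3 = mm 3 * mm 1
  ext i j; fin_cases i <;> fin_cases j <;>
    simp [mm, Matrix.mul_apply, Fin.sum_univ_three] <;> grind

/-- Evaluate a function of six reals on a complex vector. -/
def ev (f : ℝ → ℝ → ℝ → ℝ → ℝ → ℝ → ℝ) (z : Fin 3 → ℂ) : ℝ :=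
  f (aa (z 0)) (bb (z 0)) (aa (z 1)) (bb (z 1)) (aa (z 2)) (bb (z 2))

theorem mm0 (z : Fin 3 → ℂ) : mm 0 *ᵥ z = ![z 0, -z 1, -z 2] := by
  ext i; fin_cases i <;> simp [mm, Matrix.mulVec, dotProduct, Fin.sum_univ_three]
theorem mm2 (z : Fin 3 → ℂ) : mm 2 *ᵥ z = ![-z 0, z 1, -z 2] := by
  ext i; fin_cases i <;> simp [mm, Matrix.mulVec, dotProduct, Fin.sum_univ_three]
theorem mm1 (z : Fin 3 → ℂ) : mm 1 *ᵥ z =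
    ![z 0 + 2 * z 1 + -(2 * z 2), 2 * z 0 + z 1 + -(2 * z 2),
      2 * z 0 + 2 * z 1 + -(3 * z 2)] := by
  ext i; fin_cases i <;> simp [mm, Matrix.mulVec, dotProduct, Fin.sum_univ_three]
theorem mm3 (z : Fin 3 → ℂ) : mm 3 *ᵥ z =
    ![z 0 + -(2 * (z 1 + om * z 1)) + 2 * (om * z 2),
      2 * (om * z 0) + z 1 + -(2 * (z 2 + om * z 2)),
      2 * (z 0 + om * z 0) + -(2 * (om * z 1)) + -(3 * z 2)] := by
  ext i; fin_cases i <;> simp [mm, Matrix.mulVec, dotProduct, Fin.sum_univ_three] <;> ring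

theorem q_inv (i : Fin 4) (z : Fin 3 → ℂ) : ev qq (mm i *ᵥ z) = ev qq z := by
  fin_cases i
  · simp only [Fin.reduceFinMk, Fin.zero_eta, mm0, ev, Matrix.cons_val, aa_neg, bb_neg, qq, nn]; ring
  · simp only [Fin.reduceFinMk, Fin.mk_one, mm1, ev, Matrix.cons_val, aa_neg, bb_neg, aa_add, bb_add, aa_two, bb_two,
      aa_three, bb_three, qq, nn]; ring
  · simp only [Fin.reduceFinMk, mm2, ev, Matrix.cons_val, aa_neg, bb_neg, qq, nn]; ring
  · simp only [Fin.reduceFinMk, mm3, ev, Matrix.cons_val, aa_neg, bb_neg, aa_add, bb_add, aa_two, bb_two,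
      aa_three, bb_three, aa_om, bb_om, qq, nn]; ring

theorem h1_anti (z : Fin 3 → ℂ) : ev h1 (mm 0 *ᵥ z) = -ev h1 z := by
  simp only [mm0, ev, Matrix.cons_val, aa_neg, bb_neg, h1, pp]; ring
theorem h3_anti (z : Fin 3 → ℂ) : ev h3 (mm 2 *ᵥ z) = -ev h3 z := by
  simp only [mm2, ev, Matrix.cons_val, aa_neg, bb_neg, h3, pp]; ring
theorem h13_anti (z : Fin 3 → ℂ) : ev h13 (mm 0 *ᵥ mm 2 *ᵥ z) = -ev h13 z := by
  simp only [mm0, mm2, ev, Matrix.cons_val, aa_neg, bb_neg, h13, pp]; ring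
theorem h2_anti (z : Fin 3 → ℂ) : ev h2 (mm 1 *ᵥ z) = -ev h2 z := by
  simp only [mm1, ev, Matrix.cons_val, aa_neg, bb_neg, aa_add, bb_add, aa_two, bb_two,
      aa_three, bb_three, h2, pp]; ring
theorem h4_anti (z : Fin 3 → ℂ) : ev h4 (mm 3 *ᵥ z) = -ev h4 z := by
  simp only [mm3, ev, Matrix.cons_val, aa_neg, bb_neg, aa_add, bb_add, aa_two, bb_two,
      aa_three, bb_three, aa_om, bb_om, h4, pp]; ring
theorem h24_anti (z : Fin 3 → ℂ) : ev h24 (mm 1 *ᵥ mm 3 *ᵥ z) = -ev h24 z := by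
  simp only [mm1, mm3, ev, Matrix.cons_val, aa_neg, bb_neg, aa_add, bb_add, aa_two, bb_two,
      aa_three, bb_three, aa_om, bb_om, h24, pp]; ring

/-- The ping-pong sets. -/
def XX : Bool → Set (Fin 3 → ℂ)
  | false => {z | ev qq z < 0 ∧ (ev h1 z ≤ 0 ∨ ev h3 z ≤ 0 ∨ ev h13 z ≤ 0)}
  | true => {z | ev qq z < 0 ∧ (ev h2 z ≤ 0 ∨ ev h4 z ≤ 0 ∨ ev h24 z ≤ 0)}

theorem XX_true {z : Fin 3 → ℂ} (hz : z ∈ XX true) :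
    ev qq z < 0 ∧ 0 < ev h1 z ∧ 0 < ev h3 z ∧ 0 < ev h13 z := by
  obtain ⟨hq, h⟩ := hz
  refine ⟨hq, ?_, ?_, ?_⟩
  · rcases h with h | h | h
    · linarith [show 0 ≤ ev qq z + 1 * ev h1 z + 1 * ev h2 z from cert_1_2 _ _ _ _ _ _]
    · linarith [show 0 ≤ ev qq z + 1 * ev h1 z + 1 * ev h4 z from cert_1_4 _ _ _ _ _ _]
    · linarith [show 0 ≤ ev qq z + 1 * ev h1 z + 1 / 2 * ev h24 z from cert_1_24 _ _ _ _ _ _]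
  · rcases h with h | h | h
    · linarith [show 0 ≤ ev qq z + 1 * ev h3 z + 1 * ev h2 z from cert_3_2 _ _ _ _ _ _]
    · linarith [show 0 ≤ ev qq z + 1 * ev h3 z + 1 * ev h4 z from cert_3_4 _ _ _ _ _ _]
    · linarith [show 0 ≤ ev qq z + 1 * ev h3 z + 1 / 2 * ev h24 z from cert_3_24 _ _ _ _ _ _]
  · rcases h with h | h | h
    · linarith [show 0 ≤ ev qq z + 1 / 2 * ev h13 z + 1 * ev h2 z from cert_13_2 _ _ _ _ _ _]
    · linarith [show 0 ≤ ev qq z + 1 / 2 * ev h13 z + 1 * ev h4 z from cert_13_4 _ _ _ _ _ _]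
    · linarith [show 0 ≤ ev qq z + 1 / 2 * ev h13 z + 1 / 2 * ev h24 z from cert_13_24 _ _ _ _ _ _]

theorem XX_false {z : Fin 3 → ℂ} (hz : z ∈ XX false) :
    ev qq z < 0 ∧ 0 < ev h2 z ∧ 0 < ev h4 z ∧ 0 < ev h24 z := by
  have hq := hz.1
  have key : z ∉ XX true := fun h => by
    obtain ⟨_, h1, h3, h13⟩ := XX_true h
    rcases hz.2 with h | h | h <;> linarith
  refine ⟨hq, ?_, ?_, ?_⟩ <;> by_contra! h <;> exact key ⟨hq, by tauto⟩

/-- The linear action of matrix units on vectors. -/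
@[reducible]
def actM : MulAction M3ˣ (Fin 3 → ℂ) where
  smul u z := (u : M3) *ᵥ z
  one_smul z := Matrix.one_mulVec z
  mul_smul u v z := (Matrix.mulVec_mulVec z (u : M3) (v : M3)).symm

theorem model_injective :
    Function.Injective (Monoid.CoprodI.lift (wFam mu mu_sq mu_02 mu_13)) := by
  let _ : MulAction M3ˣ (Fin 3 → ℂ) := actM
  apply Monoid.CoprodI.lift_injective_of_ping_pong _ _ XX
  · intro i
    cases i
    · refine ⟨![0, 0, 1], ?_, Or.inl ?_⟩ <;>
      simp [ev, qq, h1, nn, pp, aa_zero, bb_zero, aa_one, bb_one]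
    · refine ⟨![-(om * 1), 1, 1 + -(om * 1)], ?_, Or.inr (Or.inr ?_)⟩ <;>
      simp only [ev, qq, h24, nn, pp, Matrix.cons_val, aa_neg, aa_om, aa_add, bb_neg, bb_add, bb_om,
        aa_one, bb_one] <;> norm_num
  · intro i j hij
    have key : Disjoint (XX false) (XX true) := by
      rw [Set.disjoint_left]
      intro z hz hz'
      obtain ⟨_, h1, h3, h13⟩ := XX_true hz'
      rcases hz.2 with h | h | h <;> linarith
    cases i <;> cases j
    · exact absurd rfl hij
    · exact key
    · exact key.symm
    · exact absurd rfl hij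
  · intro i j hij
    cases i <;> cases j
    · exact absurd rfl hij
    · rintro ⟨p, q⟩ hne _ ⟨z, hz, rfl⟩
      obtain ⟨hq, k1, k3, k13⟩ := XX_true hz
      rcases z2_cases p with rfl | rfl <;> rcases z2_cases q with rfl | rfl
      · exact absurd rfl hne
      · have e : wFam mu mu_sq mu_02 mu_13 false (1, sg) = mu 2 := by simp [wFam, vHom, sg_ne]
        simp only [e]
        change mm 2 *ᵥ z ∈ XX false
        exact ⟨by rw [q_inv]; exact hq, Or.inr (Or.inl (by rw [h3_anti]; linarith))⟩
      · have e : wFam mu mu_sq mu_02 mu_13 false (sg, 1) = mu 0 := by simp [wFam, vHom, sg_ne]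
        simp only [e]
        change mm 0 *ᵥ z ∈ XX false
        exact ⟨by rw [q_inv]; exact hq, Or.inl (by rw [h1_anti]; linarith)⟩
      · have e : wFam mu mu_sq mu_02 mu_13 false (sg, sg) = mu 0 * mu 2 := by
          simp [wFam, vHom, sg_ne]
        simp only [e, mul_smul]
        change mm 0 *ᵥ mm 2 *ᵥ z ∈ XX false
        exact ⟨by rw [q_inv, q_inv]; exact hq, Or.inr (Or.inr (by rw [h13_anti]; linarith))⟩
    · rintro ⟨p, q⟩ hne _ ⟨z, hz, rfl⟩
      obtain ⟨hq, k1, k3, k13⟩ := XX_false hz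
      rcases z2_cases p with rfl | rfl <;> rcases z2_cases q with rfl | rfl
      · exact absurd rfl hne
      · have e : wFam mu mu_sq mu_02 mu_13 true (1, sg) = mu 3 := by simp [wFam, vHom, sg_ne]
        simp only [e]
        change mm 3 *ᵥ z ∈ XX true
        exact ⟨by rw [q_inv]; exact hq, Or.inr (Or.inl (by rw [h4_anti]; linarith))⟩
      · have e : wFam mu mu_sq mu_02 mu_13 true (sg, 1) = mu 1 := by simp [wFam, vHom, sg_ne]
        simp only [e]
        change mm 1 *ᵥ z ∈ XX true
        exact ⟨by rw [q_inv]; exact hq, Or.inl (by rw [h2_anti]; linarith)⟩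
      · have e : wFam mu mu_sq mu_02 mu_13 true (sg, sg) = mu 1 * mu 3 := by
          simp [wFam, vHom, sg_ne]
        simp only [e, mul_smul]
        change mm 1 *ᵥ mm 3 *ᵥ z ∈ XX true
        exact ⟨by rw [q_inv, q_inv]; exact hq, Or.inr (Or.inr (by rw [h24_anti]; linarith))⟩
    · exact absurd rfl hij
  · right
    refine ⟨false, ?_⟩
    rw [Cardinal.mk_fintype, show Fintype.card VV = 4 from rfl]
    norm_num

theorem exists_model : ∃ φ : KK →* M3ˣ, (∀ i, φ (ka i) = mu i * mu (i + 1)) ∧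
    Function.Injective φ := by
  obtain ⟨f, hf⟩ := even_lift wgen wgen_sq wgen_02 wgen_13
  refine ⟨(Monoid.CoprodI.lift (wFam mu mu_sq mu_02 mu_13)).comp f, ?_, ?_⟩
  · intro i
    rw [MonoidHom.comp_apply, hf, map_mul, wlift_gen, wlift_gen]
  · exact model_injective.comp (kw_injective f hf)

/-! ### Part 3: the conjugation to the model -/

def sS : ℂ := ((Real.sqrt (1 + Real.sqrt 3) / 2 : ℝ) : ℂ)
def sB : ℂ := ((Real.sqrt 2 / 2 : ℝ) : ℂ)
def sC : ℂ := ((Real.sqrt (Real.sqrt 3 - 1) / 2 : ℝ) : ℂ)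
def sR : ℂ := ((Real.sqrt 3 : ℝ) : ℂ)

theorem sR_sq : sR * sR = 3 := by
  have h : Real.sqrt 3 * Real.sqrt 3 = 3 := Real.mul_self_sqrt (by norm_num)
  unfold sR; exact_mod_cast h

theorem sS_sq : sS * sS = (1 + sR) / 4 := by
  have h : Real.sqrt (1 + Real.sqrt 3) * Real.sqrt (1 + Real.sqrt 3) = 1 + Real.sqrt 3 :=
    Real.mul_self_sqrt (by positivity)
  have h' : Real.sqrt (1 + Real.sqrt 3) / 2 * (Real.sqrt (1 + Real.sqrt 3) / 2)
      = (1 + Real.sqrt 3) / 4 := by linarith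
  unfold sS sR; exact_mod_cast h'

theorem sB_sq : sB * sB = 1 / 2 := by
  have h : Real.sqrt 2 * Real.sqrt 2 = 2 := Real.mul_self_sqrt (by norm_num)
  have h' : Real.sqrt 2 / 2 * (Real.sqrt 2 / 2) = 1 / 2 := by linarith
  unfold sB; rw [← Complex.ofReal_mul, h']; norm_num

theorem sC_sq : sC * sC = (sR - 1) / 4 := by
  have h1 : 1 ≤ Real.sqrt 3 := Real.one_le_sqrt.2 (by norm_num)
  have h : Real.sqrt (Real.sqrt 3 - 1) * Real.sqrt (Real.sqrt 3 - 1) = Real.sqrt 3 - 1 :=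
    Real.mul_self_sqrt (by linarith)
  have h' : Real.sqrt (Real.sqrt 3 - 1) / 2 * (Real.sqrt (Real.sqrt 3 - 1) / 2)
      = (Real.sqrt 3 - 1) / 4 := by linarith
  unfold sC sR; exact_mod_cast h'

theorem conj_sS : conj sS = sS := Complex.conj_ofReal _
theorem conj_sB : conj sB = sB := Complex.conj_ofReal _
theorem conj_sC : conj sC = sC := Complex.conj_ofReal _

theorem om_eq : om = (-1 + sR * Complex.I) / 2 := by
  apply Complex.ext <;> simp [om, sR]

def nwx : Fin 4 → Fin 3 → ℂ :=
  ![![sS, sB, sC], ![-sS, -(Complex.I * sB), sC], ![sS, -sB, sC], ![-sS, Complex.I * sB, sC]]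

theorem nw_eq (k : Fin 4) : nw k = nwx k := by
  have hI := Complex.I_mul_I
  have hn : n1w = ![sS, sB, sC] := rfl
  unfold nw
  rw [hn, J3, Matrix.diagonal_pow]
  ext j
  rw [Matrix.mulVec_diagonal]
  fin_cases k <;> fin_cases j <;> simp [nwx, pow_succ]

theorem Iw_apply (k : Fin 4) (i j : Fin 3) :
    Iw k i j = -(if i = j then (1 : ℂ) else 0) + 2 * (nwx k i * (conj (nwx k j) * eta3 j)) := by
  simp [Iw, refl3, nw_eq, Matrix.vecMulVec_apply, Matrix.one_apply]

/-- `ζ = exp(5πi/6)` -/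
def sZ : ℂ := (-sR + Complex.I) / 2
def sZc : ℂ := (-sR - Complex.I) / 2

def PP : M3 :=
  !![sS, -(om * sS), sS * (sR - 1) * sZ; sB, om * sB, 0; sC, -(om * sC), sC * (sR + 1) * sZ]
def PPi : M3 :=
  !![sS, sB, -sC; (1 + om) * sS, -((1 + om) * sB), -((1 + om) * sC);
    -(sS * (sR - 1) * sZc), 0, sC * (sR + 1) * sZc]

theorem PP_mul : PP * PPi = 1 := by
  have hI := Complex.I_mul_I
  have hR := sR_sq
  have hS := sS_sq
  have hB := sB_sq
  have hC := sC_sq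
  have hSC : sS * sS * (sC * sC) = 1 / 8 := by rw [hS, hC]; linear_combination (1 / 16) * hR
  ext i j
  fin_cases i <;> fin_cases j <;>
    simp [PP, PPi, Matrix.mul_apply, Fin.sum_univ_three, om_eq, sZ, sZc] <;> grind

theorem PPi_mul : PPi * PP = 1 := _root_.mul_eq_one_comm.1 PP_mul

theorem Iw_PP (k : Fin 4) : Iw k * PP = PP * mm k := by
  have hI := Complex.I_mul_I
  have hR := sR_sq
  have hS := sS_sq
  have hB := sB_sq
  have hC := sC_sq
  ext i j
  rw [Matrix.mul_apply, Matrix.mul_apply]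
  simp only [Iw_apply, Fin.sum_univ_three]
  fin_cases k <;> fin_cases i <;> fin_cases j <;>
    simp [PP, mm, nwx, eta3, om_eq, sZ, conj_sS, conj_sB, conj_sC] <;> grind

/-! ### Part 4: discreteness -/

/-- The Eisenstein integers inside `ℂ`. -/
def eis : Subring ℂ where
  carrier := {z | ∃ a b : ℤ, z = a + b * om}
  zero_mem' := ⟨0, 0, by simp⟩
  one_mem' := ⟨1, 0, by simp⟩
  add_mem' := by
    rintro _ _ ⟨a, b, rfl⟩ ⟨c, d, rfl⟩
    exact ⟨a + c, b + d, by push_cast; ring⟩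
  neg_mem' := by
    rintro _ ⟨a, b, rfl⟩
    exact ⟨-a, -b, by push_cast; ring⟩
  mul_mem' := by
    rintro _ _ ⟨a, b, rfl⟩ ⟨c, d, rfl⟩
    exact ⟨a * c - b * d, a * d + b * c - b * d, by
      push_cast; linear_combination (b * d : ℂ) * om_sq⟩

theorem om_mem : om ∈ eis := ⟨0, 1, by simp⟩

theorem eis_small {z : ℂ} (hz : z ∈ eis) (h : ‖z‖ < 1) : z = 0 := by
  obtain ⟨a, b, rfl⟩ := hz
  have h3 : Real.sqrt 3 * Real.sqrt 3 = 3 := Real.mul_self_sqrt (by norm_num)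
  have e : Complex.normSq ((a : ℂ) + b * om) = ((a * a - a * b + b * b : ℤ) : ℝ) := by
    simp [Complex.normSq_apply, om]
    linear_combination ((b : ℝ) * b / 4) * h3
  have h2 : Complex.normSq ((a : ℂ) + b * om) < 1 := by
    rw [Complex.normSq_eq_norm_sq]
    nlinarith [norm_nonneg ((a : ℂ) + b * om)]
  rw [e] at h2
  have h4 : a * a - a * b + b * b < 1 := by exact_mod_cast h2
  have hge : 0 ≤ a * a - a * b + b * b := by nlinarith [sq_nonneg (a - b), sq_nonneg a, sq_nonneg b]
  have h5 : a * a - a * b + b * b = 0 := by omega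
  rw [h5] at e
  exact Complex.normSq_eq_zero.1 (by simpa using e)

/-- Matrix units all of whose entries (and those of the inverse) are Eisenstein integers. -/
def eisGL : Subgroup M3ˣ where
  carrier := {u | (∀ i j, (u : M3) i j ∈ eis) ∧ ∀ i j, ((u⁻¹ : M3ˣ) : M3) i j ∈ eis}
  one_mem' := by
    have : ∀ i j, (1 : M3) i j ∈ eis := by
      intro i j
      rw [Matrix.one_apply]
      split_ifs
      · exact eis.one_mem
      · exact eis.zero_mem
    exact ⟨by simpa using this, by simpa using this⟩
  mul_mem' := by
    rintro u v ⟨hu, hu'⟩ ⟨hv, hv'⟩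
    refine ⟨fun i j => ?_, fun i j => ?_⟩
    · rw [Units.val_mul, Matrix.mul_apply]
      exact eis.sum_mem fun k _ => eis.mul_mem (hu _ _) (hv _ _)
    · rw [_root_.mul_inv_rev, Units.val_mul, Matrix.mul_apply]
      exact eis.sum_mem fun k _ => eis.mul_mem (hv' _ _) (hu' _ _)
  inv_mem' := by
    rintro u ⟨hu, hu'⟩
    exact ⟨hu', by simpa using hu⟩

theorem mu_mem (i : Fin 4) : mu i ∈ eisGL := by
  have key : ∀ k l, mm i k l ∈ eis := by
    have h0 := eis.zero_mem
    have h1 := eis.one_mem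
    have h2 : (2 : ℂ) ∈ eis := ofNat_mem eis 2
    have h3 : (3 : ℂ) ∈ eis := ofNat_mem eis 3
    have ho := om_mem
    intro k l
    fin_cases i <;> fin_cases k <;> fin_cases l <;> simp only [mm] <;>
      first
      | exact h0
      | exact h1
      | exact h2
      | exact eis.neg_mem h1
      | exact eis.neg_mem h2
      | exact eis.neg_mem h3
      | exact eis.mul_mem h2 ho
      | exact eis.neg_mem (eis.mul_mem h2 ho)
      | exact eis.mul_mem h2 (eis.add_mem h1 ho)
      | exact eis.mul_mem h2 (eis.sub_mem (eis.neg_mem h1) ho)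
  exact ⟨key, key⟩

def PU : M3ˣ := ⟨PP, PPi, PP_mul, PPi_mul⟩

theorem discrete_of_conj (S : Subgroup M3ˣ) (hS : ∀ g ∈ S, PU⁻¹ * g * PU ∈ eisGL) :
    DiscreteTopology S := by
  apply discreteTopology_of_isOpen_singleton_one
  let F : S → M3 := fun g => PPi * ((g : M3ˣ) : M3) * PP
  have hF : Continuous F := by
    have : Continuous fun g : S => ((g : M3ˣ) : M3) :=
      Units.continuous_val.comp continuous_subtype_val
    exact (continuous_const.mul this).mul continuous_const
  have hO : IsOpen {g : S | ∀ i j, ‖F g i j - (1 : M3) i j‖ < 1} := by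
    simp only [Set.setOf_forall]
    refine isOpen_iInter_of_finite fun i => isOpen_iInter_of_finite fun j => ?_
    exact isOpen_lt (((hF.matrix_elem i j).sub continuous_const).norm) continuous_const
  convert hO
  ext g
  simp only [Set.mem_singleton_iff, Set.mem_setOf_eq]
  constructor
  · rintro rfl i j
    have : F 1 = 1 := by
      show PPi * 1 * PP = 1
      rw [Matrix.mul_one, PPi_mul]
    simp [this]
  · intro h
    have hm := (hS g g.2).1
    have e : F g = 1 := by
      ext i j
      have h1 : F g i j ∈ eis := hm i j
      have h2 : (1 : M3) i j ∈ eis := eisGL.one_mem.1 i j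
      exact sub_eq_zero.1 (eis_small (eis.sub_mem h1 h2) (h i j))
    have e' : PU⁻¹ * (g : M3ˣ) * PU = 1 := Units.ext e
    apply Subtype.ext
    show (g : M3ˣ) = 1
    have := congrArg (fun x => PU * x * PU⁻¹) e'
    simpa [mul_assoc] using this

theorem Iw_eq (k : Fin 4) : Iw k = PP * mm k * PPi := by
  rw [← Iw_PP, Matrix.mul_assoc, PP_mul, Matrix.mul_one]

theorem Aw_eq (k : Fin 4) :
    ((PU * (mu k * mu (k + 1)) * PU⁻¹ : M3ˣ) : M3) = Aw k := by
  show PP * (mm k * mm (k + 1)) * PPi = Aw k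
  rw [Aw, Iw_eq, Iw_eq]
  simp only [Matrix.mul_assoc]
  rw [← Matrix.mul_assoc PPi PP, PPi_mul, Matrix.one_mul]

/-- θ = 5π/6 case, in `PU(2,1)`: the matrices `A₁,A₂,A₃,A₄` in
`GL(3,ℂ)` satisfy `A₁A₂A₃A₄ = Id` and `(A_iA_{i+1})² = Id` (indices mod 4); the
induced homomorphism `K → GL(3,ℂ)`, `a_i ↦ A_i`, is injective; and the subgroup
of `GL(3,ℂ)` generated by `A₁,A₂,A₃,A₄` is discrete. -/
theorem main_discrete_faithful_2dim :
    Aw 0 * Aw 1 * Aw 2 * Aw 3 = 1 ∧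
    (∀ i : Fin 4, (Aw i * Aw (i + 1)) ^ 2 = 1) ∧
    ∃ U : Fin 4 → (Matrix (Fin 3) (Fin 3) ℂ)ˣ,
      (∀ i : Fin 4, (U i : Matrix (Fin 3) (Fin 3) ℂ) = Aw i) ∧
      (∃ φ : PresentedGroup relsK →* (Matrix (Fin 3) (Fin 3) ℂ)ˣ,
        (∀ i : Fin 4, φ (PresentedGroup.of i) = U i) ∧ Function.Injective φ) ∧
      DiscreteTopology ↥(Subgroup.closure (Set.range U)) := by
  obtain ⟨φ, hφ, hinj⟩ := exists_model
  let ψ : KK →* M3ˣ := (MulAut.conj PU).toMonoidHom.comp φ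
  have hψ : ∀ i, ((ψ (ka i) : M3ˣ) : M3) = Aw i := by
    intro i
    rw [← Aw_eq, ← hφ]
    rfl
  refine ⟨?_, ?_, fun i => ψ (ka i), hψ, ⟨ψ, fun i => rfl, ?_⟩, ?_⟩
  · have := congrArg (fun g => ((ψ g : M3ˣ) : M3)) k_prod
    simpa only [map_mul, Units.val_mul, hψ, map_one, Units.val_one] using this
  · have h : ∀ a b : Fin 4, (ka a * ka b) ^ 2 = 1 → (Aw a * Aw b) ^ 2 = 1 := by
      intro a b hab
      have := congrArg (fun g => ((ψ g : M3ˣ) : M3)) hab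
      simpa only [map_mul, map_pow, Units.val_pow_eq_pow_val, Units.val_mul, hψ, map_one,
        Units.val_one] using this
    intro i
    fin_cases i
    · exact h 0 1 k_01
    · exact h 1 2 k_12
    · exact h 2 3 k_23
    · exact h 3 0 k_30
  · exact (MulAut.conj PU).injective.comp hinj
  · apply discrete_of_conj
    intro g hg
    induction hg using Subgroup.closure_induction with
    | mem x hx =>
      obtain ⟨i, rfl⟩ := hx
      have : PU⁻¹ * ψ (ka i) * PU = mu i * mu (i + 1) := by
        show PU⁻¹ * (PU * φ (ka i) * PU⁻¹) * PU = _
        rw [hφ]; group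
      rw [this]
      exact eisGL.mul_mem (mu_mem _) (mu_mem _)
    | one => simpa using eisGL.one_mem
    | mul x y _ _ hx hy =>
      have := eisGL.mul_mem hx hy
      simpa [mul_assoc] using this
    | inv x _ hx =>
      have := eisGL.inv_mem hx
      simpa [mul_assoc] using this
end
end
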